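/- Let (r₁,…,rₘ) and (s₁,…,sₘ) be two irreducible r-sequences of regular elements of IG(E). Then r₁r₂⋯rₘ = s₁s₂⋯sₘ in IG(E) if and only if the two sequences are related by the reflexive–transitive closure of the relation ↔, where (r₁,…,rₘ) ↔ (s₁,…,sₘ) iff there exist k < m and e ∈ E such that either rₖ = sₖ·ē and sₖ₊₁ = ē·rₖ₊₁ with r_l = s_l for all l ∉ {k, k+1}, or sₖ = rₖ·ē and rₖ₊₁ = ē·sₖ₊₁ with r_l = s_l for all l ∉ {k, k+1}. -/

import Mathlib

section Green

variable {T : Type*} [Semigroup T]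

/-- Green's relation 𝓡. -/
def GreenR (a b : T) : Prop := a = b ∨ ∃ x y : T, a * x = b ∧ b * y = a

/-- Green's relation 𝓛. -/
def GreenL (a b : T) : Prop := a = b ∨ ∃ x y : T, x * a = b ∧ y * b = a

/-- Green's relation 𝓓 = 𝓡 ∘ 𝓛. -/
def GreenD (a b : T) : Prop := ∃ c : T, GreenR a c ∧ GreenL c b

/-- An element is regular if `a = a * b * a` for some `b`. -/
def IsRegularElem (a : T) : Prop := ∃ b : T, a * b * a = a

/-- The principal two-sided ideal `T¹ a T¹`. -/
def principalIdeal (a : T) : Set T :=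
  {x | x = a ∨ (∃ u, u * a = x) ∨ (∃ v, a * v = x) ∨ ∃ u v, u * a * v = x}

/-- Green's relation 𝓙. -/
def GreenJ (a b : T) : Prop := principalIdeal a = principalIdeal b

/-- The 𝓙-preorder. -/
def JleRel (a b : T) : Prop := principalIdeal a ⊆ principalIdeal b

/-- Strict 𝓙-order. -/
def JltRel (a b : T) : Prop := JleRel a b ∧ ¬ JleRel b a

/-- `u` is a (two-sided) identity element. -/
def IsIdentityElem (u : T) : Prop := ∀ x : T, u * x = x ∧ x * u = x

/-- The relation 𝓡̃. -/
def RTilde (a b : T) : Prop := ∀ ε : T, ε * ε = ε → (ε * a = a ↔ ε * b = b)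

/-- The relation 𝓛̃. -/
def LTilde (a b : T) : Prop := ∀ ε : T, ε * ε = ε → (a * ε = a ↔ b * ε = b)

/-- `blockProd p i k = p i * p (i+1) * ⋯ * p (i+k)`. -/
def blockProd (p : ℕ → T) (i : ℕ) : ℕ → T
  | 0 => p i
  | k + 1 => blockProd p i k * p (i + (k + 1))

/-- Multiply `x` by optional (possibly empty) words on both sides. -/
def withCtx (u : Option T) (x : T) (v : Option T) : T :=
  match u, v with
  | none, none => x
  | some u', none => u' * x
  | none, some v' => x * v'
  | some u', some v' => u' * x * v'

/-- Multiply by an optional word on the left. -/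
def leftCtx (u : Option T) (x : T) : T := match u with | none => x | some u' => u' * x

/-- Multiply by an optional word on the right. -/
def rightCtx (x : T) (v : Option T) : T := match v with | none => x | some v' => x * v'

end Green

section IGdef

/-- The set of idempotents of `S`. -/
abbrev IdemE (S : Type*) [Semigroup S] : Type _ := {x : S // x * x = x}

variable {S : Type*} [Semigroup S]

/-- `e, f` form a basic pair if `{e,f} ∩ {ef,fe} ≠ ∅`. -/
def BasicPair (e f : IdemE S) : Prop :=
  (e : S) * f = e ∨ (e : S) * f = f ∨ (f : S) * e = e ∨ (f : S) * e = f

/-- The defining relations of IG(E): `ef = g` whenever `e, f` is a basic pair with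
product `g` in `S`. -/
def igRelBase (u v : FreeSemigroup (IdemE S)) : Prop :=
  ∃ e f g : IdemE S, BasicPair e f ∧ (g : S) = (e : S) * (f : S) ∧
    u = FreeSemigroup.of e * FreeSemigroup.of f ∧ v = FreeSemigroup.of g

/-- The congruence on the free semigroup `E⁺` generated by the defining relations. -/
def igCon (S : Type*) [Semigroup S] : Con (FreeSemigroup (IdemE S)) :=
  conGen (fun u v => igRelBase u v)

/-- The free idempotent generated semigroup IG(E). -/
abbrev IG (S : Type*) [Semigroup S] := (igCon S).Quotient

/-- `w̄`, the image of a word `w ∈ E⁺` in IG(E). -/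
def igBar (w : FreeSemigroup (IdemE S)) : IG S := (w : (igCon S).Quotient)

/-- The list of letters of a word. -/
def wordList (w : FreeSemigroup (IdemE S)) : List (IdemE S) := w.head :: w.tail

/-- The length of a word. -/
def wlen (w : FreeSemigroup (IdemE S)) : ℕ := (wordList w).length

/-- Length of an optional word. -/
def olen (u : Option (FreeSemigroup (IdemE S))) : ℕ :=
  match u with | none => 0 | some u' => wlen u'

/-- `p 1, …, p m` is an r-factorisation of `w`: each factor represents a regular
element of IG(E). -/
def IsRFact (w : FreeSemigroup (IdemE S)) (m : ℕ) (p : ℕ → FreeSemigroup (IdemE S)) : Prop :=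
  1 ≤ m ∧ blockProd p 1 (m - 1) = w ∧ ∀ i, 1 ≤ i → i ≤ m → IsRegularElem (igBar (p i))

/-- A minimal r-factorisation: no product of two or more consecutive factors is regular. -/
def IsMinRFact (w : FreeSemigroup (IdemE S)) (m : ℕ) (p : ℕ → FreeSemigroup (IdemE S)) : Prop :=
  IsRFact w m p ∧
    ∀ i j, 1 ≤ i → i < j → j ≤ m → ¬ IsRegularElem (igBar (blockProd p i (j - i)))

/-- The relation ≈ on m-tuples of words. -/
def TupleApprox (m : ℕ) (p q : ℕ → FreeSemigroup (IdemE S)) : Prop :=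
  (∃ i, 1 ≤ i ∧ i ≤ m ∧ igBar (p i) = igBar (q i) ∧
    ∀ j, 1 ≤ j → j ≤ m → j ≠ i → p j = q j) ∨
  (∃ i, ∃ e : IdemE S, 1 ≤ i ∧ i < m ∧
    igBar (p i) = igBar (q i * FreeSemigroup.of e) ∧
    igBar (q (i + 1)) = igBar (FreeSemigroup.of e * p (i + 1)) ∧
    ∀ j, 1 ≤ j → j ≤ m → j ≠ i → j ≠ i + 1 → p j = q j) ∨
  (∃ i, ∃ e : IdemE S, 1 ≤ i ∧ i < m ∧
    igBar (q i) = igBar (p i * FreeSemigroup.of e) ∧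
    igBar (p (i + 1)) = igBar (FreeSemigroup.of e * q (i + 1)) ∧
    ∀ j, 1 ≤ j → j ≤ m → j ≠ i → j ≠ i + 1 → p j = q j)

/-- The relation ∼: the transitive closure of ≈. -/
def TupleSim (m : ℕ) (p q : ℕ → FreeSemigroup (IdemE S)) : Prop :=
  Relation.TransGen (TupleApprox m) p q

/-- One application of a defining relation of IG(E) inside a word. -/
def RewriteStep (w w' : FreeSemigroup (IdemE S)) : Prop :=
  ∃ (u v : Option (FreeSemigroup (IdemE S))) (x y : FreeSemigroup (IdemE S)),
    (igRelBase x y ∨ igRelBase y x) ∧ w = withCtx u x v ∧ w' = withCtx u y v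

/-- `e` is a seed of `w` at (1-based) position `k`. -/
def SeedAt (w : FreeSemigroup (IdemE S)) (e : IdemE S) (k : ℕ) : Prop :=
  ∃ u v : Option (FreeSemigroup (IdemE S)),
    w = withCtx u (FreeSemigroup.of e) v ∧ k = olen u + 1 ∧
    GreenL (igBar (leftCtx u (FreeSemigroup.of e))) (igBar (FreeSemigroup.of e)) ∧
    GreenR (igBar (FreeSemigroup.of e)) (igBar (rightCtx (FreeSemigroup.of e) v))

/-- The coordinate (position within `w` of the first letter) of the `i`-th factor. -/
def wcoord (p : ℕ → FreeSemigroup (IdemE S)) (i : ℕ) : ℕ :=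
  1 + ∑ j ∈ Finset.Ico 1 i, wlen (p j)

end IGdef

/-- An irreducible r-sequence `r 1, …, r m` of regular elements of IG(E):
no nontrivial product of consecutive entries is regular. -/
def IsIrrRSeq {S : Type*} [Semigroup S] (m : ℕ) (r : ℕ → IG S) : Prop :=
  1 ≤ m ∧ (∀ i, 1 ≤ i → i ≤ m → IsRegularElem (r i)) ∧
    ∀ i j, 1 ≤ i → i < j → j ≤ m → ¬ IsRegularElem (blockProd r i (j - i))

/-- The basic swap defining the relation ↔ on irreducible r-sequences. -/
def RSwapBase {S : Type*} [Semigroup S] (m : ℕ) (r s : ℕ → IG S) : Prop :=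
  ∃ k, 1 ≤ k ∧ k < m ∧ (∀ l, 1 ≤ l → l ≤ m → l ≠ k → l ≠ k + 1 → r l = s l) ∧
    ((∃ e : IdemE S, r k = s k * igBar (FreeSemigroup.of e) ∧
        s (k + 1) = igBar (FreeSemigroup.of e) * r (k + 1)) ∨
     (∃ e : IdemE S, s k = r k * igBar (FreeSemigroup.of e) ∧
        r (k + 1) = igBar (FreeSemigroup.of e) * s (k + 1)))

/-- The relation ↔ on irreducible r-sequences. -/
def RSwap {S : Type*} [Semigroup S] (m : ℕ) (r s : ℕ → IG S) : Prop :=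
  IsIrrRSeq m r ∧ IsIrrRSeq m s ∧ RSwapBase m r s

/-- Since sequences are modelled as functions `ℕ → IG S`, two functions represent
the same m-tuple iff they agree on the window `[1, m]`. -/
def EqOnWindow {S : Type*} [Semigroup S] (m : ℕ) (r s : ℕ → IG S) : Prop :=
  ∀ l, 1 ≤ l → l ≤ m → r l = s l

section Factorisation

variable {M : Type*} [Monoid M]

/-- `a` is 𝓡-related to `a * b`. -/
def StableR (a b : M) : Prop := ∃ y, a * b * y = a

/-- `b` is 𝓛-related to `a * b`. -/
def StableL (a b : M) : Prop := ∃ y, y * (a * b) = b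

theorem StableR.mul_left {a b : M} (h : StableR a b) (c : M) : StableR (c * a) b := by
  obtain ⟨y, hy⟩ := h
  exact ⟨y, by rw [mul_assoc c, mul_assoc c, hy]⟩

theorem StableL.mul_right {a b : M} (h : StableL a b) (c : M) : StableL a (b * c) := by
  obtain ⟨y, hy⟩ := h
  exact ⟨y, by rw [← mul_assoc a, ← mul_assoc y, hy]⟩

theorem StableR.of_mul {a b c : M} (h : StableR a (b * c)) :
    StableR a b ∧ StableR (a * b) c := by
  obtain ⟨y, hy⟩ := h
  exact ⟨⟨c * y, by simpa [mul_assoc] using hy⟩, ⟨y * b, by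
    calc a * b * c * (y * b) = a * (b * c) * y * b := by simp [mul_assoc]
      _ = a * b := by rw [hy]⟩⟩

theorem StableL.of_mul {a b c : M} (h : StableL (a * b) c) :
    StableL b c ∧ StableL a (b * c) := by
  obtain ⟨y, hy⟩ := h
  exact ⟨⟨y * a, by simpa [mul_assoc] using hy⟩, ⟨b * y, by
    calc b * y * (a * (b * c)) = b * (y * (a * b * c)) := by simp [mul_assoc]
      _ = b * c := by rw [hy]⟩⟩

/-- A predicate that is invariant under 𝓡 and 𝓛, and such that a product satisfying it
is 𝓡-related to its left factor or 𝓛-related to its right factor. -/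
structure IsSplitPred (P : M → Prop) : Prop where
  right : ∀ {a b}, StableR a b → (P (a * b) ↔ P a)
  left : ∀ {a b}, StableL a b → (P (a * b) ↔ P b)
  split : ∀ {a b}, P (a * b) → StableR a b ∨ StableL a b

/-- A list of elements satisfying `P` none of whose adjacent products satisfies `P`. -/
def IsIrrList (P : M → Prop) (l : List M) : Prop :=
  (∀ a ∈ l, P a) ∧ l.IsChain fun a b => ¬ P (a * b)

variable {P : M → Prop}

theorem isIrrList_nil : IsIrrList P [] := by simp [IsIrrList]

theorem isIrrList_singleton {a : M} : IsIrrList P [a] ↔ P a := by simp [IsIrrList]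

theorem isIrrList_cons_cons {a b : M} {l : List M} :
    IsIrrList P (a :: b :: l) ↔ P a ∧ ¬ P (a * b) ∧ IsIrrList P (b :: l) := by
  simp only [IsIrrList, List.isChain_cons_cons, List.forall_mem_cons]
  tauto

theorem isIrrList_append {l₁ l₂ : List M} :
    IsIrrList P (l₁ ++ l₂) ↔ IsIrrList P l₁ ∧ IsIrrList P l₂ ∧
      ∀ x ∈ l₁.getLast?, ∀ y ∈ l₂.head?, ¬ P (x * y) := by
  simp only [IsIrrList, List.isChain_append, List.forall_mem_append]
  tauto

theorem IsIrrList.of_cons {a : M} {l : List M} (h : IsIrrList P (a :: l)) :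
    P a ∧ IsIrrList P l :=
  ⟨h.1 a (by simp), fun b hb => h.1 b (by simp [hb]), h.2.tail⟩

theorem IsIrrList.infix {l l' : List M} (h : IsIrrList P l) (h' : l' <:+: l) :
    IsIrrList P l' :=
  ⟨fun a ha => h.1 a (h'.subset ha), h.2.infix h'⟩

/-- A product of at least two consecutive entries of an irreducible list never
satisfies `P`. -/
theorem IsIrrList.not_prod (hP : IsSplitPred P) : ∀ {l : List M} {a b : M},
    IsIrrList P (a :: b :: l) → ¬ P (a :: b :: l).prod := by
  intro l
  induction l with
  | nil => intro a b h; simpa using (isIrrList_cons_cons.1 h).2.1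
  | cons c l ih =>
    intro a b h hp
    obtain ⟨_, hab, hb⟩ := isIrrList_cons_cons.1 h
    rw [List.prod_cons, List.prod_cons, ← mul_assoc] at hp
    rcases hP.split hp with hs | hs
    · exact hab ((hP.right hs).1 hp)
    · refine ih hb ?_
      rw [List.prod_cons]
      exact (hP.left hs.of_mul.1).2 ((hP.left hs).1 hp)

theorem isIrrList_mul_cons (hP : IsSplitPred P) {b c : M} (hc : StableL b c) {C : List M} :
    IsIrrList P ((b * c) :: C) ↔ IsIrrList P (c :: C) := by
  have h₂ : ∀ y : M, P (b * c * y) ↔ P (c * y) := fun y => by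
    rw [mul_assoc]; exact hP.left (hc.mul_right y)
  cases C with
  | nil => simpa only [isIrrList_singleton] using hP.left hc
  | cons d C => simp only [isIrrList_cons_cons, hP.left hc, h₂]

/-- Moving a factor across a boundary preserves irreducibility. -/
theorem isIrrList_move (hP : IsSplitPred P) {A C : List M} {x b c : M}
    (hx : StableR x b) (hc : StableL b c) :
    IsIrrList P (A ++ (x * b) :: c :: C) ↔ IsIrrList P (A ++ x :: (b * c) :: C) := by
  have h₁ : ∀ y : M, P (y * (x * b)) ↔ P (y * x) := fun y => by
    rw [← mul_assoc]; exact hP.right (hx.mul_left y)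
  simp only [isIrrList_append, isIrrList_cons_cons, hP.right hx, isIrrList_mul_cons hP hc,
    List.head?_cons,
    Option.mem_some_iff, forall_eq', h₁, mul_assoc]

/-- Across a boundary of two irreducible lists the moved factor acts stably. -/
theorem IsIrrList.stable (hP : IsSplitPred P) {A C : List M} {x b c : M}
    (h : IsIrrList P (A ++ (x * b) :: c :: C)) (h' : IsIrrList P (A ++ x :: (b * c) :: C)) :
    StableR x b ∧ StableL b c := by
  obtain ⟨hxb, hn, hc⟩ := isIrrList_cons_cons.1 (isIrrList_append.1 h).2.1
  obtain ⟨hx, -, hbc⟩ := isIrrList_cons_cons.1 (isIrrList_append.1 h').2.1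
  constructor
  · refine (hP.split hxb).resolve_right fun hs => hn ?_
    rw [mul_assoc]
    exact (hP.left (hs.mul_right c)).2 hbc.of_cons.1
  · refine (hP.split hbc.of_cons.1).resolve_left fun hs => hn ?_
    exact (hP.right (hs.mul_left x)).2 hxb

open Classical in
/-- Left multiplication of an irreducible list by an element, absorbing entries as long as
the product satisfies `P`. -/
noncomputable def absorb (P : M → Prop) : M → List M → List M
  | a, [] => [a]
  | a, r :: l => if P (a * r) then absorb P (a * r) l else a :: r :: l

theorem absorb_cons_of_pos {a r : M} (l : List M) (h : P (a * r)) :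
    absorb P a (r :: l) = absorb P (a * r) l := by simp [absorb, h]

theorem absorb_of_isIrrList {a : M} {l : List M} (h : IsIrrList P (a :: l)) :
    absorb P a l = a :: l := by
  cases l with
  | nil => rfl
  | cons r l => simp [absorb, (isIrrList_cons_cons.1 h).2.1]

theorem isIrrList_absorb : ∀ {l : List M} {a : M}, P a → IsIrrList P l →
    IsIrrList P (absorb P a l)
  | [], _, ha, _ => isIrrList_singleton.2 ha
  | r :: l, a, ha, hl => by
    by_cases h : P (a * r)
    · rw [absorb_cons_of_pos l h]
      exact isIrrList_absorb h hl.of_cons.2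
    · have := isIrrList_cons_cons.2 ⟨ha, h, hl⟩
      rwa [absorb_of_isIrrList this]

theorem exists_absorb_eq : ∀ (l : List M) (a : M),
    ∃ σ τ, l = σ ++ τ ∧ absorb P a l = (a * σ.prod) :: τ
  | [], a => ⟨[], [], by simp [absorb]⟩
  | r :: l, a => by
    by_cases h : P (a * r)
    · obtain ⟨σ, τ, rfl, h'⟩ := exists_absorb_eq l (a * r)
      exact ⟨r :: σ, τ, rfl, by rw [absorb_cons_of_pos _ h, h']; simp [mul_assoc]⟩
    · exact ⟨[], r :: l, rfl, by simp [absorb, h]⟩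

theorem prod_absorb (l : List M) (a : M) : (absorb P a l).prod = a * l.prod := by
  obtain ⟨σ, τ, rfl, h⟩ := exists_absorb_eq (P := P) l a
  rw [h]; simp [mul_assoc]

variable {E : Type*} (ι : E → M)

/-- Moving a generator across a boundary of an irreducible list. -/
def IrrSwap (P : M → Prop) (l l' : {l : List M // IsIrrList P l}) : Prop :=
  ∃ A x e c C, l.1 = A ++ (x * ι e) :: c :: C ∧ l'.1 = A ++ x :: (ι e * c) :: C

/-- Irreducible lists up to moving generators across boundaries. -/
abbrev IrrClass (P : M → Prop) := Quot (IrrSwap ι P)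

/-- The class of an irreducible list. -/
def irrClass (l : List M) (h : IsIrrList P l) : IrrClass ι P := Quot.mk _ ⟨l, h⟩

variable {ι}

theorem irrClass_congr {l l' : List M} (e : l = l') (h : IsIrrList P l) :
    irrClass ι l h = irrClass ι l' (e ▸ h) := by subst e; rfl

variable (ι) in
/-- Two lists are irreducible and have the same class. -/
def IrrEquiv (P : M → Prop) (l l' : List M) : Prop :=
  ∃ h h', irrClass (P := P) ι l h = irrClass ι l' h'

theorem IrrEquiv.refl {l : List M} (h : IsIrrList P l) : IrrEquiv ι P l l := ⟨h, h, rfl⟩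

theorem IrrEquiv.trans {l₁ l₂ l₃ : List M} (h : IrrEquiv ι P l₁ l₂) (h' : IrrEquiv ι P l₂ l₃) :
    IrrEquiv ι P l₁ l₃ := by
  obtain ⟨h₁, _, e⟩ := h
  obtain ⟨_, h₃, e'⟩ := h'
  exact ⟨h₁, h₃, e.trans e'⟩

theorem irrEquiv_move (hP : IsSplitPred P) (hι : Submonoid.closure (Set.range ι) = ⊤)
    {A C : List M} {x b c : M} (hx : StableR x b) (hc : StableL b c)
    (h : IsIrrList P (A ++ (x * b) :: c :: C)) :
    IrrEquiv ι P (A ++ (x * b) :: c :: C) (A ++ x :: (b * c) :: C) := by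
  have hb : b ∈ Submonoid.closure (Set.range ι) := hι ▸ Submonoid.mem_top b
  induction hb using Submonoid.closure_induction generalizing x c with
  | mem b hb =>
    obtain ⟨e, rfl⟩ := hb
    exact ⟨h, (isIrrList_move hP hx hc).1 h, Quot.sound ⟨A, x, e, c, C, rfl, rfl⟩⟩
  | one => simpa using IrrEquiv.refl (ι := ι) h
  | mul b₁ b₂ _ _ ih₁ ih₂ =>
    obtain ⟨hx₁, hx₂⟩ := hx.of_mul
    obtain ⟨hc₂, hc₁⟩ := hc.of_mul
    rw [← mul_assoc] at h ⊢
    rw [mul_assoc b₁]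
    exact (ih₂ hx₂ hc₂ h).trans (ih₁ hx₁ hc₁ ((isIrrList_move hP hx₂ hc₂).1 h))

theorem absorb_move (hP : IsSplitPred P) {x c : M} {e : E} {C : List M} :
    ∀ {A : List M} {a : M} (_ : P a) (_ : IsIrrList P (A ++ (x * ι e) :: c :: C))
      (_ : IsIrrList P (A ++ x :: (ι e * c) :: C)),
      IrrEquiv ι P (absorb P a (A ++ (x * ι e) :: c :: C))
        (absorb P a (A ++ x :: (ι e * c) :: C))
  | [], a, ha, h, h' => by
    refine ⟨isIrrList_absorb ha h, isIrrList_absorb ha h', ?_⟩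
    obtain ⟨hx, hc⟩ := h.stable hP h'
    have hiff : P (a * x * ι e) ↔ P (a * x) := hP.right (hx.mul_left a)
    by_cases hp : P (a * x)
    · by_cases hq : P (a * x * ι e * c)
      · exact irrClass_congr (by simp [absorb, ← mul_assoc, hp, hq, hiff]) _
      · exact Quot.sound ⟨[], a * x, e, c, C, by simp [absorb, ← mul_assoc, hp, hq, hiff],
          by simp [absorb, ← mul_assoc, hp, hq]⟩
    · exact Quot.sound ⟨[a], x, e, c, C, by simp [absorb, ← mul_assoc, hp, hiff],
        by simp [absorb, hp]⟩
  | b :: A, a, ha, h, h' => by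
    by_cases hab : P (a * b)
    · simp only [List.cons_append, absorb_cons_of_pos _ hab]
      exact absorb_move hP hab h.of_cons.2 h'.of_cons.2
    · refine ⟨isIrrList_absorb ha h, isIrrList_absorb ha h',
        Quot.sound ⟨a :: b :: A, x, e, c, C, ?_, ?_⟩⟩
      · simp [absorb, hab]
      · simp [absorb, hab]

/-- Absorbing a product is the same as absorbing its two factors in turn. -/
theorem absorb_mul (hP : IsSplitPred P) (hι : Submonoid.closure (Set.range ι) = ⊤) {a : M}
    (ha : P a) : ∀ {l : List M} {b : M} (_ : P b) (_ : P (a * b)) (_ : IsIrrList P l),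
      IrrEquiv ι P (absorb P (a * b) l) (absorb P a (absorb P b l))
  | [], b, hb, hab, _ => by
    simpa [absorb, hab] using IrrEquiv.refl (ι := ι) (isIrrList_singleton.2 hab)
  | r :: l, b, hb, hab, h => by
    obtain ⟨hr, hl⟩ := h.of_cons
    by_cases hbr : P (b * r)
    · rw [absorb_cons_of_pos l hbr]
      by_cases habr : P (a * b * r)
      · rw [absorb_cons_of_pos l habr, mul_assoc]
        exact absorb_mul hP hι ha hbr (by rwa [← mul_assoc]) hl
      · have hL : StableL b r := (hP.split hbr).resolve_left fun hs =>
          habr ((hP.right (hs.mul_left a)).2 hab)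
        have hR : StableR a b := (hP.split hab).resolve_right fun hs =>
          habr (by rw [mul_assoc]; exact (hP.left (hs.mul_right r)).2 hbr)
        have h₁ : IsIrrList P ((a * b) :: r :: l) := isIrrList_cons_cons.2 ⟨hab, habr, h⟩
        have h₂ := (isIrrList_move (A := []) hP hR hL).1 h₁
        have h₃ : IsIrrList P (b * r :: l) := h₂.of_cons.2
        have h₄ : IsIrrList P (a :: (b * r) :: l) := h₂
        rw [absorb_of_isIrrList h₁, absorb_of_isIrrList h₃, absorb_of_isIrrList h₄]
        exact irrEquiv_move (A := []) hP hι hR hL h₁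
    · rw [absorb_of_isIrrList (isIrrList_cons_cons.2 ⟨hb, hbr, h⟩), absorb_cons_of_pos _ hab]
      exact IrrEquiv.refl (isIrrList_absorb hab h)

/-- The action of an element satisfying `P` on classes of irreducible lists. -/
noncomputable def classAbsorb (hP : IsSplitPred P) (a : M) (ha : P a) :
    IrrClass ι P → IrrClass ι P :=
  Quot.lift (fun l => irrClass ι (absorb P a l.1) (isIrrList_absorb ha l.2)) (by
    rintro ⟨_, h⟩ ⟨_, h'⟩ ⟨A, x, e, c, C, rfl, rfl⟩
    obtain ⟨_, _, h⟩ := absorb_move hP ha h h'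
    exact h)

theorem classAbsorb_irrClass (hP : IsSplitPred P) {a : M} (ha : P a) {l : List M}
    (h : IsIrrList P l) :
    classAbsorb hP a ha (irrClass ι l h) = irrClass ι _ (isIrrList_absorb ha h) := rfl

theorem classAbsorb_mul (hP : IsSplitPred P) (hι : Submonoid.closure (Set.range ι) = ⊤)
    {a b : M} (ha : P a) (hb : P b) (hab : P (a * b)) (q : IrrClass ι P) :
    classAbsorb hP (a * b) hab q = classAbsorb hP a ha (classAbsorb hP b hb q) := by
  induction q using Quot.ind with
  | mk l =>
    obtain ⟨_, _, h⟩ := absorb_mul hP hι ha hb hab l.2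
    exact h

theorem IrrSwap.prod_eq {l l' : {l : List M // IsIrrList P l}} (h : IrrSwap ι P l l') :
    l.1.prod = l'.1.prod := by
  obtain ⟨A, x, e, c, C, h, h'⟩ := h
  simp [h, h', mul_assoc]

/-- The last entries of equivalent irreducible lists are 𝓛-related, the first ones are
𝓡-related, and the lengths agree. -/
theorem IrrSwap.invariants (hP : IsSplitPred P) {l l' : {l : List M // IsIrrList P l}}
    (h : IrrSwap ι P l l') :
    l.1.length = l'.1.length ∧
      (∀ a ∈ l.1.getLast?, ∀ b ∈ l'.1.getLast?, (∃ y, a = y * b) ∧ ∃ y, b = y * a) ∧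
      ∀ a ∈ l.1.head?, ∀ b ∈ l'.1.head?, a ∣ b ∧ b ∣ a := by
  obtain ⟨_, hl⟩ := l
  obtain ⟨_, hl'⟩ := l'
  obtain ⟨A, x, e, c, C, rfl, rfl⟩ := h
  obtain ⟨⟨y, hx⟩, ⟨z, hc⟩⟩ := hl.stable hP hl'
  refine ⟨by simp, ?_, ?_⟩
  · rcases C.eq_nil_or_concat with rfl | ⟨C, d, rfl⟩
    · have h₁ : (A ++ [x * ι e, c]).getLast? = some c := by simp
      have h₂ : (A ++ [x, ι e * c]).getLast? = some (ι e * c) := by simp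
      rintro a ha b hb
      simp only [h₁, h₂, Option.mem_some_iff] at ha hb
      subst ha hb
      exact ⟨⟨z, hc.symm⟩, ⟨_, rfl⟩⟩
    · have h₁ : (A ++ (x * ι e) :: c :: (C ++ [d])).getLast? = some d := by
        exact List.getLast?_eq_some_iff.2 ⟨A ++ (x * ι e) :: c :: C, by simp⟩
      have h₂ : (A ++ x :: (ι e * c) :: (C ++ [d])).getLast? = some d := by
        exact List.getLast?_eq_some_iff.2 ⟨A ++ x :: (ι e * c) :: C, by simp⟩
      rintro a ha b hb
      simp only [List.concat_eq_append, h₁, h₂, Option.mem_some_iff] at ha hb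
      subst ha hb
      exact ⟨⟨1, by simp⟩, ⟨1, by simp⟩⟩
  · cases A with
    | nil =>
      rintro a ha b hb
      simp only [List.nil_append, List.head?_cons, Option.mem_some_iff] at ha hb
      subst ha hb
      exact ⟨⟨y, hx.symm⟩, ⟨_, rfl⟩⟩
    | cons d A =>
      rintro a ha b hb
      simp only [List.cons_append, List.head?_cons, Option.mem_some_iff] at ha hb
      subst ha hb
      exact ⟨dvd_rfl, dvd_rfl⟩

/-- Properties shared by equivalent irreducible lists. -/
theorem irrClass_invariants (hP : IsSplitPred P) {l l' : {l : List M // IsIrrList P l}}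
    (h : Relation.EqvGen (IrrSwap ι P) l l') :
    l.1.length = l'.1.length ∧
      (∀ a ∈ l.1.getLast?, ∀ b ∈ l'.1.getLast?, (∃ y, a = y * b) ∧ ∃ y, b = y * a) ∧
      ∀ a ∈ l.1.head?, ∀ b ∈ l'.1.head?, a ∣ b ∧ b ∣ a := by
  induction h with
  | rel _ _ h => exact h.invariants hP
  | refl _ =>
    refine ⟨rfl, fun _ ha _ hb => ?_, fun _ ha _ hb => ?_⟩
    · obtain rfl := Option.mem_unique ha hb
      exact ⟨⟨1, by simp⟩, ⟨1, by simp⟩⟩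
    · obtain rfl := Option.mem_unique ha hb
      exact ⟨dvd_rfl, dvd_rfl⟩
  | symm _ _ _ ih =>
    exact ⟨ih.1.symm, fun a ha b hb => (ih.2.1 b hb a ha).symm,
      fun a ha b hb => (ih.2.2 b hb a ha).symm⟩
  | trans l₁ l₂ l₃ _ _ ih ih' =>
    refine ⟨ih.1.trans ih'.1, fun a ha c hc => ?_, fun a ha c hc => ?_⟩
    · have hne : l₂.1 ≠ [] := by
        rintro h0
        have : l₁.1 = [] := List.length_eq_zero_iff.1 (by simp [ih.1, h0])
        simp [this] at ha
      have hb := List.getLast?_eq_some_getLast hne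
      obtain ⟨⟨y, hy⟩, z, hz⟩ := ih.2.1 a ha _ hb
      obtain ⟨⟨y', hy'⟩, z', hz'⟩ := ih'.2.1 _ hb c hc
      exact ⟨⟨y * y', by rw [hy, mul_assoc, ← hy']⟩, ⟨z' * z, by rw [hz', hz, mul_assoc]⟩⟩
    · have hne : l₂.1 ≠ [] := by
        rintro h0
        have : l₁.1 = [] := List.length_eq_zero_iff.1 (by simp [ih.1, h0])
        simp [this] at ha
      have hb := List.head?_eq_some_head hne
      obtain ⟨h₁, h₂⟩ := ih.2.2 a ha _ hb
      obtain ⟨h₃, h₄⟩ := ih'.2.2 _ hb c hc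
      exact ⟨h₁.trans h₃, h₄.trans h₂⟩

end Factorisation

section IdemClass

variable {M : Type*} [Monoid M] {E : Type*}

/-- The elements 𝓓-related to a generator. -/
inductive IdemClass (ι : E → M) : M → Prop
  | gen (e : E) : IdemClass ι (ι e)
  | right {a b : M} (ha : IdemClass ι a) (hab : StableR a b) : IdemClass ι (a * b)
  | left {a b : M} (hb : IdemClass ι b) (hab : StableL a b) : IdemClass ι (a * b)

variable {ι : E → M}

theorem IdemClass.of_dvd {a b : M} (h : IdemClass ι a) (hab : a ∣ b) (hba : b ∣ a) :
    IdemClass ι b := by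
  obtain ⟨x, rfl⟩ := hab
  obtain ⟨y, hy⟩ := hba
  exact h.right ⟨y, hy.symm⟩

theorem IdemClass.of_left {a b : M} (h : IdemClass ι a) (hab : ∃ x, b = x * a)
    (hba : ∃ y, a = y * b) : IdemClass ι b := by
  obtain ⟨x, rfl⟩ := hab
  obtain ⟨y, hy⟩ := hba
  exact h.left ⟨y, hy.symm⟩

theorem idemClass_isSplitPred
    (h : ∀ {a b}, IdemClass ι (a * b) → StableR a b ∨ StableL a b) :
    IsSplitPred (IdemClass ι) where
  right := fun ⟨y, hy⟩ => ⟨fun h => h.of_dvd ⟨y, hy.symm⟩ ⟨_, rfl⟩, fun h => h.right ⟨y, hy⟩⟩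
  left := fun ⟨y, hy⟩ => ⟨fun h => h.of_left ⟨y, hy.symm⟩ ⟨_, rfl⟩, fun h => h.left ⟨y, hy⟩⟩
  split := h

variable (hP : IsSplitPred (IdemClass ι)) (hι : Submonoid.closure (Set.range ι) = ⊤)
  (act : M →* Function.End (IrrClass ι (IdemClass ι)))
  (hact : ∀ e, act (ι e) = classAbsorb hP (ι e) (.gen e))

include hι hact

theorem act_mul_of_stableR {a b : M} (ha : IdemClass ι a) (hb : StableR a b)
    (q : IrrClass ι (IdemClass ι)) :
    classAbsorb hP (a * b) (ha.right hb) q = classAbsorb hP a ha (act b q) := by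
  have hb' : b ∈ Submonoid.closure (Set.range ι) := hι ▸ Submonoid.mem_top b
  induction hb' using Submonoid.closure_induction generalizing a q with
  | mem b hb' =>
    obtain ⟨e, rfl⟩ := hb'
    rw [hact]
    exact classAbsorb_mul hP hι ha _ _ q
  | one => simp; rfl
  | mul b₁ b₂ _ _ ih₁ ih₂ =>
    obtain ⟨h₁, h₂⟩ := hb.of_mul
    rw [map_mul]
    refine .trans ?_ (ih₁ ha h₁ (act b₂ q))
    rw [← ih₂ (ha.right h₁) h₂ q]
    simp only [mul_assoc]

theorem act_mul_of_stableL {a b : M} (hb : IdemClass ι b) (ha : StableL a b)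
    (q : IrrClass ι (IdemClass ι)) :
    classAbsorb hP (a * b) (hb.left ha) q = act a (classAbsorb hP b hb q) := by
  have ha' : a ∈ Submonoid.closure (Set.range ι) := hι ▸ Submonoid.mem_top a
  induction ha' using Submonoid.closure_induction generalizing b q with
  | mem a ha' =>
    obtain ⟨e, rfl⟩ := ha'
    rw [hact]
    exact classAbsorb_mul hP hι _ hb _ q
  | one => simp; rfl
  | mul a₁ a₂ _ _ ih₁ ih₂ =>
    obtain ⟨h₂, h₁⟩ := ha.of_mul
    rw [map_mul]
    refine .trans ?_ (congrArg (act a₁) (ih₂ hb h₂ q))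
    rw [← ih₁ (hb.left h₂) h₁ q]
    simp only [mul_assoc]

theorem act_eq_classAbsorb {a : M} (ha : IdemClass ι a) : act a = classAbsorb hP a ha := by
  induction ha with
  | gen e => exact hact e
  | right ha hb ih =>
    funext q
    rw [act_mul_of_stableR hP hι act hact ha hb, map_mul, ← ih]
    rfl
  | left hb ha ih =>
    funext q
    rw [act_mul_of_stableL hP hι act hact hb ha, map_mul, ← ih]
    rfl

theorem act_prod_nil {l : List M} (h : IsIrrList (IdemClass ι) l) :
    act l.prod (irrClass ι [] isIrrList_nil) = irrClass ι l h := by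
  induction l with
  | nil => simp; rfl
  | cons a l ih =>
    rw [List.prod_cons, map_mul]
    refine (congrArg (act a) (ih h.of_cons.2)).trans ?_
    rw [act_eq_classAbsorb hP hι act hact h.of_cons.1, classAbsorb_irrClass]
    exact irrClass_congr (absorb_of_isIrrList h) _

/-- Irreducible lists with the same product are equivalent. -/
theorem eqvGen_of_prod_eq {l l' : List M} (h : IsIrrList (IdemClass ι) l)
    (h' : IsIrrList (IdemClass ι) l') (e : l.prod = l'.prod) :
    Relation.EqvGen (IrrSwap ι (IdemClass ι)) ⟨l, h⟩ ⟨l', h'⟩ := by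
  refine Quot.eqvGen_exact ?_
  have h₁ := act_prod_nil hP hι act hact h
  rw [e, act_prod_nil hP hι act hact h'] at h₁
  exact h₁.symm

omit hact in
theorem exists_isIrrList (a : M) : ∃ l, IsIrrList (IdemClass ι) l ∧ l.prod = a := by
  have ha : a ∈ Submonoid.closure (Set.range ι) := hι ▸ Submonoid.mem_top a
  induction ha using Submonoid.closure_induction_left with
  | one => exact ⟨[], isIrrList_nil, rfl⟩
  | mul_left x hx y _ ih =>
    obtain ⟨e, rfl⟩ := hx
    obtain ⟨l, hl, rfl⟩ := ih
    exact ⟨_, isIrrList_absorb (.gen e) hl, prod_absorb l _⟩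

include hP in
omit hι hact in
/-- If `c` can be absorbed from the left by the last entry of an irreducible list, then it
absorbs a final segment of that list. -/
theorem exists_isIrrList_append_cons {b c : M} {τ : List M} (hc : StableL b c)
    (hτ : IsIrrList (IdemClass ι) (c :: τ)) {A : List M}
    (hA : IsIrrList (IdemClass ι) (A ++ [b])) :
    ∃ A₁ A₂, A = A₁ ++ A₂ ∧
      IsIrrList (IdemClass ι) (A₁ ++ (A₂.prod * (b * c)) :: τ) := by
  induction A with
  | nil => exact ⟨[], [], rfl, by simpa using (isIrrList_mul_cons hP hc).2 hτ⟩
  | cons a A ih =>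
    obtain ⟨A₁, A₂, rfl, h⟩ := ih hA.of_cons.2
    have ha := hA.of_cons.1
    cases A₁ with
    | cons a₁ A₁ =>
      exact ⟨a :: a₁ :: A₁, A₂, rfl,
        isIrrList_cons_cons.2 ⟨ha, (isIrrList_cons_cons.1 hA).2.1, h⟩⟩
    | nil =>
      rw [List.nil_append] at h hA
      by_cases hp : IdemClass ι (a * (A₂.prod * (b * c)))
      · refine ⟨[], a :: A₂, rfl, ?_⟩
        have hassoc : (a :: A₂).prod * (b * c) = (a :: (A₂ ++ [b])).prod * c := by
          simp [mul_assoc]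
        rw [List.nil_append, hassoc]
        rw [← mul_assoc, ← List.prod_cons, hassoc] at hp
        refine (isIrrList_mul_cons hP ((hP.split hp).resolve_left fun hs => ?_)).2 hτ
        have hpb := (hP.right hs).1 hp
        cases A₂ with
        | nil => exact hA.not_prod hP hpb
        | cons d A₂ => exact hA.not_prod hP hpb
      · exact ⟨[a], A₂, rfl, isIrrList_cons_cons.2 ⟨ha, hp, h⟩⟩

theorem isIrrList_invariants {l l' : List M} (h : IsIrrList (IdemClass ι) l)
    (h' : IsIrrList (IdemClass ι) l') (e : l.prod = l'.prod) :
    l.length = l'.length ∧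
      (∀ a ∈ l.getLast?, ∀ b ∈ l'.getLast?, (∃ y, a = y * b) ∧ ∃ y, b = y * a) ∧
      ∀ a ∈ l.head?, ∀ b ∈ l'.head?, a ∣ b ∧ b ∣ a :=
  irrClass_invariants hP (eqvGen_of_prod_eq hP hι act hact h h' e)

/-- An idempotent other than the identity is 𝓓-related to a generator. -/
theorem idemClass_of_idempotent {t : M} (ht : t * t = t) (h1 : t ≠ 1) : IdemClass ι t := by
  obtain ⟨l, hl, hlt⟩ := exists_isIrrList hι t
  obtain rfl | ⟨A, b, rfl⟩ := l.eq_nil_or_concat'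
  · exact absurd hlt.symm h1
  have hb : IdemClass ι b := hl.1 b (by simp)
  have htb : A.prod * b = t := by simp [← hlt]
  obtain ⟨σ, τ, hστ, habs⟩ := exists_absorb_eq (P := IdemClass ι) (A ++ [b]) b
  have hirr := isIrrList_absorb hb hl
  rw [habs] at hirr
  have hστt : σ.prod * τ.prod = t := by rw [← List.prod_append, ← hστ, hlt]
  have hpb := hirr.of_cons.1
  have hR : StableR b σ.prod → IdemClass ι t := fun hs => by
    have hirr' : IsIrrList (IdemClass ι) (A ++ (b * σ.prod) :: τ) := by
      obtain ⟨hA, -, hAb⟩ := isIrrList_append.1 hl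
      refine isIrrList_append.2 ⟨hA, hirr, fun x hx y hy => ?_⟩
      obtain rfl : b * σ.prod = y := by simpa using hy
      rw [← mul_assoc, hP.right (hs.mul_left x)]
      exact hAb x hx b (by simp)
    obtain ⟨hlen, hlast, -⟩ := isIrrList_invariants hP hι act hact hl hirr' (by
      rw [hlt, List.prod_append, List.prod_cons, mul_assoc, hστt, ← mul_assoc, htb, ht])
    obtain rfl : τ = [] := List.length_eq_zero_iff.1 (by simpa using hlen)
    obtain ⟨⟨y, hy⟩, -⟩ := hlast b (by simp) (b * σ.prod) (by simp)
    refine hb.of_left ⟨_, htb.symm⟩ ⟨y * b, ?_⟩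
    rw [← hστt, List.prod_nil, mul_one, mul_assoc, ← hy]
  rcases hP.split hpb with hs | hs
  · exact hR hs
  match σ with
  | [] => exact hR ⟨1, by simp⟩
  | c :: d :: σ =>
    have : IsIrrList (IdemClass ι) (c :: d :: σ) :=
      hl.infix (hστ ▸ (List.prefix_append _ _).isInfix)
    exact absurd ((hP.left hs).1 hpb) (this.not_prod hP)
  | [c] =>
    simp only [List.prod_singleton] at hs hστt
    have hl' := hl
    rw [hστ, List.singleton_append] at hl'
    obtain ⟨A₁, A₂, rfl, hirr'⟩ := exists_isIrrList_append_cons hP hs hl' hl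
    obtain ⟨hlen, -, hhead⟩ := isIrrList_invariants hP hι act hact hl' hirr' (by
      have : (A₁ ++ A₂.prod * (b * c) :: τ).prod = (A₁ ++ A₂).prod * b * (c * τ.prod) := by
        simp [mul_assoc]
      rw [this, htb, List.prod_cons, hστt, ht])
    obtain rfl : A₁ = [] := by simpa using hlen
    rw [List.nil_append] at htb hhead
    obtain ⟨-, z, hz⟩ := hhead c (by simp) (A₂.prod * (b * c)) (by simp)
    refine (hl'.of_cons.1).of_dvd ⟨_, hστt.symm⟩ ⟨c * z, ?_⟩
    rw [← htb, mul_assoc, ← mul_assoc b, ← mul_assoc, ← hz]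

theorem idemClass_of_regular {a b : M} (hab : a * b * a = a) (h1 : b * a ≠ 1) :
    IdemClass ι a := by
  refine (idemClass_of_idempotent hP hι act hact (t := b * a) ?_ h1).of_left
    ⟨a, by rw [← mul_assoc, hab]⟩ ⟨b, rfl⟩
  rw [mul_assoc, ← mul_assoc a, hab]

omit hP hι hact in
theorem IdemClass.regular (hidem : ∀ e, ι e * ι e = ι e) {a : M} (ha : IdemClass ι a) :
    ∃ b, a * b * a = a := by
  induction ha with
  | gen e => exact ⟨ι e, by rw [hidem, hidem]⟩
  | @right a b _ hab ih =>
    obtain ⟨c, hc⟩ := ih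
    obtain ⟨y, hy⟩ := hab
    exact ⟨y * c, by rw [← mul_assoc (a * b), hy, ← mul_assoc, hc]⟩
  | @left a b _ hab ih =>
    obtain ⟨c, hc⟩ := ih
    obtain ⟨y, hy⟩ := hab
    exact ⟨c * y, by rw [mul_assoc, mul_assoc c, hy, mul_assoc, ← mul_assoc b, hc]⟩

end IdemClass

section IG

variable {S : Type*} [Semigroup S]

/-- A generator of IG(E), in the monoid obtained by adjoining an identity. -/
def igGen (e : IdemE S) : WithOne (IG S) := (igBar (FreeSemigroup.of e) : IG S)

/-- The element represented by a possibly empty word. -/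
def igProd (l : List (IdemE S)) : WithOne (IG S) := (l.map igGen).prod

theorem igProd_append (l l' : List (IdemE S)) : igProd (l ++ l') = igProd l * igProd l' := by
  simp [igProd]

theorem igProd_cons (e : IdemE S) (l : List (IdemE S)) :
    igProd (e :: l) = igGen e * igProd l := by
  simp [igProd]

theorem igProd_wordList (w : FreeSemigroup (IdemE S)) : igProd (wordList w) = igBar w := by
  induction w using FreeSemigroup.recOnMul with
  | ih1 e => simp [igProd, wordList, igGen, FreeSemigroup.of]
  | ih2 e w _ h =>
    change igProd (e :: wordList w) = _
    rw [igProd_cons, h]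
    rfl

theorem igBar_surjective (a : IG S) : ∃ w, igBar w = a := Con.induction_on a fun w => ⟨w, rfl⟩

theorem exists_igProd_eq (a : WithOne (IG S)) : ∃ l, igProd l = a := by
  refine WithOne.cases_on a ⟨[], rfl⟩ fun a => ?_
  obtain ⟨w, rfl⟩ := igBar_surjective a
  exact ⟨wordList w, igProd_wordList w⟩

theorem closure_igGen :
    Submonoid.closure (Set.range (igGen : IdemE S → WithOne (IG S))) = ⊤ := by
  refine eq_top_iff.2 fun a _ => ?_
  obtain ⟨l, rfl⟩ := exists_igProd_eq a
  refine Submonoid.list_prod_mem _ fun x hx => ?_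
  obtain ⟨e, -, rfl⟩ := List.mem_map.1 hx
  exact Submonoid.subset_closure ⟨e, rfl⟩

theorem igGen_mul {e f g : IdemE S} (h : BasicPair e f) (hg : (g : S) = e * f) :
    igGen e * igGen f = igGen g :=
  congrArg WithOne.coe ((Con.eq _).2 (ConGen.Rel.of _ _ ⟨e, f, g, h, hg, rfl, rfl⟩))

theorem igGen_idem (e : IdemE S) : igGen e * igGen e = igGen e :=
  igGen_mul (.inl e.2) e.2.symm

/-- A word contains a letter that is 𝓛-related to the prefix ending in it and 𝓡-related to
the suffix starting with it. -/
def HasSeed (l : List (IdemE S)) : Prop :=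
  ∃ u e v, l = u ++ e :: v ∧ StableL (igProd u) (igGen e) ∧ StableR (igGen e) (igProd v)

theorem hasSeed_append {l l' : List (IdemE S)} : HasSeed (l ++ l') ↔
    (∃ u e v, l = u ++ e :: v ∧ StableL (igProd u) (igGen e) ∧
      StableR (igGen e) (igProd (v ++ l'))) ∨
    (∃ u e v, l' = u ++ e :: v ∧ StableL (igProd (l ++ u)) (igGen e) ∧
      StableR (igGen e) (igProd v)) := by
  constructor
  · rintro ⟨u, e, v, h, hu, hv⟩
    rcases List.append_eq_append_iff.1 h with ⟨w, rfl, h'⟩ | ⟨w, rfl, h'⟩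
    · exact .inr ⟨w, e, v, h', hu, hv⟩
    · cases w with
      | nil =>
        exact .inr ⟨[], e, v, by simpa using h'.symm, by simpa using hu, hv⟩
      | cons a w =>
        obtain ⟨rfl, rfl⟩ := List.cons_eq_cons.1 h'
        exact .inl ⟨u, e, w, rfl, hu, hv⟩
  · rintro (⟨u, e, v, rfl, hu, hv⟩ | ⟨u, e, v, rfl, hu, hv⟩)
    · exact ⟨u, e, v ++ l', by simp, hu, hv⟩
    · exact ⟨l ++ u, e, v, by simp, hu, hv⟩

/-- The statement that some letter of `l` is a seed of `x ++ l ++ y`. -/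
theorem hasSeed_context {x l y : List (IdemE S)} : HasSeed (x ++ (l ++ y)) ↔
    (∃ u e v, x = u ++ e :: v ∧ StableL (igProd u) (igGen e) ∧
      StableR (igGen e) (igProd v * igProd l * igProd y)) ∨
    (∃ u e v, l = u ++ e :: v ∧ StableL (igProd x * igProd u) (igGen e) ∧
      StableR (igGen e) (igProd v * igProd y)) ∨
    (∃ u e v, y = u ++ e :: v ∧ StableL (igProd x * igProd l * igProd u) (igGen e) ∧
      StableR (igGen e) (igProd v)) := by
  rw [hasSeed_append]
  refine or_congr (by simp only [igProd_append, mul_assoc]) ?_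
  constructor
  · rintro ⟨u, e, v, h, hu, hv⟩
    rcases List.append_eq_append_iff.1 h with ⟨w, rfl, h'⟩ | ⟨w, rfl, h'⟩
    · refine .inr ⟨w, e, v, h', ?_, hv⟩
      simpa only [igProd_append, mul_assoc] using hu
    · cases w with
      | nil =>
        refine .inr ⟨[], e, v, by simpa using h'.symm, ?_, hv⟩
        rw [igProd_append] at hu
        simpa [igProd] using hu
      | cons a w =>
        obtain ⟨rfl, rfl⟩ := List.cons_eq_cons.1 h'
        rw [igProd_append] at hu
        refine .inl ⟨u, e, w, rfl, hu, ?_⟩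
        rw [← igProd_append]
        exact hv
  · rintro (⟨u, e, v, rfl, hu, hv⟩ | ⟨u, e, v, rfl, hu, hv⟩)
    · refine ⟨u, e, v ++ y, by simp, ?_⟩
      simpa only [igProd_append] using ⟨hu, hv⟩
    · refine ⟨l ++ u, e, v, by simp, ?_⟩
      rw [igProd_append, igProd_append, ← mul_assoc]
      exact ⟨hu, hv⟩

theorem exists_singleton_eq_append_cons {α : Type*} {p : List α → α → List α → Prop} {a : α} :
    (∃ u e v, [a] = u ++ e :: v ∧ p u e v) ↔ p [] a [] := by
  constructor
  · rintro ⟨u, e, v, h, hp⟩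
    cases u <;> simp_all
  · exact fun h => ⟨[], a, [], rfl, h⟩

theorem exists_pair_eq_append_cons {α : Type*} {p : List α → α → List α → Prop} {a b : α} :
    (∃ u e v, [a, b] = u ++ e :: v ∧ p u e v) ↔ p [] a [b] ∨ p [a] b [] := by
  constructor
  · rintro ⟨_ | ⟨c, u⟩, e, v, h, hp⟩
    · simp_all
    · cases u <;> simp_all
  · rintro (h | h)
    exacts [⟨[], a, [b], rfl, h⟩, ⟨[a], b, [], rfl, h⟩]

theorem hasSeed_pair {e f g : IdemE S} (h : BasicPair e f) (hg : (g : S) = e * f)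
    (x y : List (IdemE S)) :
    HasSeed (x ++ ([e, f] ++ y)) ↔ HasSeed (x ++ ([g] ++ y)) := by
  have hef := igGen_mul h hg
  have he := igGen_idem e
  have hf := igGen_idem f
  have hπ : igProd [e, f] = igProd [g] := by simp [igProd, hef]
  rw [hasSeed_context, hasSeed_context, hπ]
  refine or_congr Iff.rfl (or_congr ?_ Iff.rfl)
  rw [exists_pair_eq_append_cons, exists_singleton_eq_append_cons]
  simp only [igProd, List.map_nil, List.map_cons, List.prod_nil, List.prod_cons, mul_one,
    one_mul, ← hef]
  generalize (x.map igGen).prod = p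
  generalize (y.map igGen).prod = q
  have hcase : igGen e * igGen f = igGen e ∨ igGen e * igGen f = igGen f ∨
      igGen f * igGen e = igGen e ∨ igGen f * igGen e = igGen f := by
    have h' : BasicPair f e := by
      rcases h with h | h | h | h
      exacts [.inr (.inr (.inr h)), .inr (.inr (.inl h)), .inr (.inl h), .inl h]
    rcases h with h | h | h | h
    exacts [.inl (igGen_mul (.inl h) h.symm), .inr (.inl (igGen_mul (.inr (.inl h)) h.symm)),
      .inr (.inr (.inl (igGen_mul h' h.symm))), .inr (.inr (.inr (igGen_mul h' h.symm)))]
  generalize igGen e = e at *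
  generalize igGen f = f at *
  constructor
  · rintro (⟨⟨c, hc⟩, ⟨d, hd⟩⟩ | ⟨⟨c, hc⟩, ⟨d, hd⟩⟩)
    · refine ⟨⟨c, ?_⟩, ⟨d * f, ?_⟩⟩
      · rw [← mul_assoc p, ← mul_assoc c, hc]
      · calc e * f * q * (d * f) = e * (f * q) * d * f := by simp only [mul_assoc]
          _ = e * f := by rw [hd]
    · refine ⟨⟨e * c, ?_⟩, ⟨d, ?_⟩⟩
      · calc e * c * (p * (e * f)) = e * (c * (p * e * f)) := by simp only [mul_assoc]
          _ = e * f := by rw [hc]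
      · rw [mul_assoc, mul_assoc, ← mul_assoc f, hd]
  · rintro ⟨⟨c, hc⟩, ⟨d, hd⟩⟩
    rcases hcase with h | h | h | h
    · rw [h] at hc hd
      exact .inl ⟨⟨c, hc⟩, d, by rw [← mul_assoc, h, hd]⟩
    · rw [h] at hc hd
      exact .inr ⟨⟨c, by rw [mul_assoc p, h, hc]⟩, d, hd⟩
    · refine .inl ⟨⟨c, ?_⟩, d * e, ?_⟩
      · calc c * (p * e) = c * (p * (e * f)) * e := by
              simp only [mul_assoc, h, he]
          _ = e := by rw [hc, mul_assoc, h, he]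
      · calc e * (f * q) * (d * e) = e * f * q * d * e := by simp only [mul_assoc]
          _ = e := by rw [hd, mul_assoc, h, he]
    · refine .inr ⟨⟨f * c, ?_⟩, d, ?_⟩
      · calc f * c * (p * e * f) = f * (c * (p * (e * f))) := by simp only [mul_assoc]
          _ = f := by rw [hc, ← mul_assoc, h, hf]
      · have h2 : f * (e * f) = f := by rw [← mul_assoc, h, hf]
        calc f * q * d = f * (e * f * q * d) := by
              simp only [← mul_assoc, h, hf]
          _ = f := by rw [hd, h2]

/-- Words with equal images in IG(E) have seeds in every context simultaneously. -/
theorem hasSeed_context_congr {w w' : FreeSemigroup (IdemE S)} (h : igBar w = igBar w')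
    (x y : List (IdemE S)) :
    HasSeed (x ++ (wordList w ++ y)) ↔ HasSeed (x ++ (wordList w' ++ y)) := by
  let c : Con (FreeSemigroup (IdemE S)) :=
    { r := fun w w' => ∀ x y,
        HasSeed (x ++ (wordList w ++ y)) ↔ HasSeed (x ++ (wordList w' ++ y))
      iseqv := ⟨fun _ _ _ => Iff.rfl, fun h x y => (h x y).symm,
        fun h h' x y => (h x y).trans (h' x y)⟩
      mul' := by
        intro w₁ w₂ w₃ w₄ h h' x y
        have hw : ∀ w w' : FreeSemigroup (IdemE S),
            wordList (w * w') = wordList w ++ wordList w' := fun _ _ => rfl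
        rw [hw, hw, List.append_assoc, h, ← List.append_assoc, h', List.append_assoc,
          List.append_assoc] }
  have hle : igCon S ≤ c := Con.conGen_le.2 (by
    rintro _ _ ⟨e, f, g, hb, hg, rfl, rfl⟩ x y
    exact hasSeed_pair hb hg x y)
  exact hle ((Con.eq _).1 h) x y

theorem HasSeed.congr {l l' : List (IdemE S)} (hl : HasSeed l) (h : igProd l = igProd l') :
    HasSeed l' := by
  have key : ∀ (e : IdemE S) (l : List (IdemE S)),
      igProd (e :: l) = igBar ⟨e, l⟩ := fun e l => igProd_wordList ⟨e, l⟩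
  match l, l' with
  | [], _ => obtain ⟨u, e, v, h, -⟩ := hl; simp at h
  | e :: l, [] =>
    rw [key] at h
    exact absurd h WithOne.coe_ne_one
  | e :: l, e' :: l' =>
    rw [key, key] at h
    simpa [wordList] using
      (hasSeed_context_congr (WithOne.coe_injective h) [] []).1 (by simpa [wordList] using hl)

theorem IdemClass.hasSeed {a : WithOne (IG S)} (h : IdemClass igGen a) {l : List (IdemE S)}
    (hl : igProd l = a) : HasSeed l := by
  induction h generalizing l with
  | gen e =>
    refine HasSeed.congr (l := [e]) ?_ (by rw [hl]; simp [igProd])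
    exact ⟨[], e, [], rfl, ⟨1, by simp [igProd]⟩, ⟨1, by simp [igProd]⟩⟩
  | @right a b _ hab ih =>
    obtain ⟨wa, rfl⟩ := exists_igProd_eq a
    obtain ⟨wb, rfl⟩ := exists_igProd_eq b
    refine HasSeed.congr (l := wa ++ wb) ?_ (by rw [igProd_append, hl])
    obtain ⟨u, e, v, rfl, ⟨c, hc⟩, ⟨d, hd⟩⟩ := ih rfl
    obtain ⟨y, hy⟩ := hab
    refine hasSeed_append.2 (.inl ⟨u, e, v, rfl, ⟨c, hc⟩, y * d, ?_⟩)
    rw [igProd_append, igProd_cons] at hy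
    rw [igProd_append]
    calc igGen e * (igProd v * igProd wb) * (y * d)
        = c * (igProd u * igGen e) * (igProd v * igProd wb) * (y * d) := by rw [hc]
      _ = c * (igProd u * (igGen e * igProd v) * igProd wb * y) * d := by simp only [mul_assoc]
      _ = c * (igProd u * igGen e) * igProd v * d := by rw [hy]; simp only [mul_assoc]
      _ = igGen e := by rw [hc, hd]
  | @left a b _ hab ih =>
    obtain ⟨wa, rfl⟩ := exists_igProd_eq a
    obtain ⟨wb, rfl⟩ := exists_igProd_eq b
    refine HasSeed.congr (l := wa ++ wb) ?_ (by rw [igProd_append, hl])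
    obtain ⟨u, e, v, rfl, ⟨c, hc⟩, ⟨d, hd⟩⟩ := ih rfl
    obtain ⟨y, hy⟩ := hab
    refine hasSeed_append.2 (.inr ⟨u, e, v, rfl, ⟨c * y, ?_⟩, d, hd⟩)
    rw [igProd_append, igProd_cons] at hy
    rw [igProd_append]
    calc c * y * (igProd wa * igProd u * igGen e)
        = c * y * (igProd wa * igProd u * (igGen e * igProd v * d)) := by rw [hd]
      _ = c * (y * (igProd wa * (igProd u * (igGen e * igProd v)))) * d := by
        simp only [mul_assoc]
      _ = c * (igProd u * igGen e) * igProd v * d := by rw [hy]; simp only [mul_assoc]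
      _ = igGen e := by rw [hc, hd]

theorem isSplitPred_igGen : IsSplitPred (IdemClass (igGen : IdemE S → WithOne (IG S))) := by
  refine idemClass_isSplitPred fun {a b} h => ?_
  obtain ⟨wa, rfl⟩ := exists_igProd_eq a
  obtain ⟨wb, rfl⟩ := exists_igProd_eq b
  rcases hasSeed_append.1 (h.hasSeed (igProd_append wa wb)) with
    ⟨u, e, v, rfl, -, y, hy⟩ | ⟨u, e, v, rfl, ⟨y, hy⟩, -⟩
  · refine .inl ⟨y * igProd v, ?_⟩
    rw [igProd_append] at hy
    rw [igProd_append, igProd_cons]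
    calc igProd u * (igGen e * igProd v) * igProd wb * (y * igProd v)
        = igProd u * (igGen e * (igProd v * igProd wb) * y) * igProd v := by
          simp only [mul_assoc]
      _ = igProd u * (igGen e * igProd v) := by rw [hy, mul_assoc]
  · refine .inr ⟨igProd u * y, ?_⟩
    rw [igProd_append] at hy
    rw [igProd_append, igProd_cons]
    calc igProd u * y * (igProd wa * (igProd u * (igGen e * igProd v)))
        = igProd u * (y * (igProd wa * igProd u * igGen e)) * igProd v := by
          simp only [mul_assoc]
      _ = igProd u * (igGen e * igProd v) := by rw [hy, mul_assoc]

/-- IG(E) with an identity adjoined acts on classes of irreducible lists. -/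
theorem exists_igAct : ∃ act : WithOne (IG S) →* Function.End (IrrClass igGen (IdemClass igGen)),
    ∀ e : IdemE S, act (igGen e) = classAbsorb isSplitPred_igGen (igGen e) (.gen e) := by
  let F : FreeSemigroup (IdemE S) →ₙ* Function.End (IrrClass igGen (IdemClass igGen)) :=
    FreeSemigroup.lift fun e => classAbsorb isSplitPred_igGen (igGen e) (.gen e)
  have hF : igCon S ≤ Con.ker F := Con.conGen_le.2 (by
    rintro _ _ ⟨e, f, g, hb, hg, rfl, rfl⟩
    have h := igGen_mul hb hg
    rw [Con.ker_rel, map_mul]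
    funext q
    refine (classAbsorb_mul isSplitPred_igGen closure_igGen (.gen e) (.gen f) (h ▸ .gen g)
      q).symm.trans ?_
    change _ = classAbsorb isSplitPred_igGen (igGen g) (.gen g) q
    simp only [h])
  let G : IG S →ₙ* Function.End (IrrClass igGen (IdemClass igGen)) :=
    { toFun := fun a => Con.liftOn a F fun _ _ h => hF h
      map_mul' := fun a b => Con.induction_on₂ a b fun u v => map_mul F u v }
  exact ⟨WithOne.lift G, fun e => WithOne.lift_coe G _⟩

theorem isRegularElem_iff (a : IG S) :
    IsRegularElem a ↔ IdemClass igGen (a : WithOne (IG S)) := by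
  constructor
  · rintro ⟨b, hb⟩
    obtain ⟨act, hact⟩ := exists_igAct (S := S)
    exact idemClass_of_regular (b := (b : WithOne (IG S))) isSplitPred_igGen closure_igGen act hact
      (by rw [← WithOne.coe_mul, ← WithOne.coe_mul, hb])
      (by rw [← WithOne.coe_mul]; exact WithOne.coe_ne_one)
  · intro h
    obtain ⟨b, hb⟩ := h.regular igGen_idem
    revert hb
    refine WithOne.cases_on b (fun hb => ?_) fun b hb => ?_
    · rw [mul_one, ← WithOne.coe_mul] at hb
      have := WithOne.coe_injective hb
      exact ⟨a, by rw [this, this]⟩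
    · rw [← WithOne.coe_mul, ← WithOne.coe_mul] at hb
      exact ⟨b, WithOne.coe_injective hb⟩

theorem IdemClass.ne_one {a : WithOne (IG S)} (h : IdemClass igGen a) : a ≠ 1 := by
  rintro rfl
  obtain ⟨u, e, v, h, -⟩ := h.hasSeed (l := []) rfl
  simp at h

/-- The list `r i, …, r (i + n - 1)` in IG(E) with an identity adjoined. -/
def igSeg (r : ℕ → IG S) (i n : ℕ) : List (WithOne (IG S)) :=
  (List.range n).map fun j => (r (i + j) : WithOne (IG S))

theorem length_igSeg (r : ℕ → IG S) (i n : ℕ) : (igSeg r i n).length = n := by simp [igSeg]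

theorem igSeg_add (r : ℕ → IG S) (i a b : ℕ) :
    igSeg r i (a + b) = igSeg r i a ++ igSeg r (i + a) b := by
  simp [igSeg, List.range_add, Function.comp_def, add_assoc]

theorem igSeg_succ (r : ℕ → IG S) (i n : ℕ) :
    igSeg r i (n + 1) = (r i : WithOne (IG S)) :: igSeg r (i + 1) n := by
  rw [add_comm, igSeg_add]
  rfl

theorem igSeg_getElem? (r : ℕ → IG S) (i : ℕ) {n j : ℕ} (h : j < n) :
    (igSeg r i n)[j]? = some (r (i + j) : WithOne (IG S)) := by
  simp [igSeg, h]

theorem igSeg_congr {r s : ℕ → IG S} {i n : ℕ} (h : ∀ j < n, r (i + j) = s (i + j)) :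
    igSeg r i n = igSeg s i n :=
  List.map_congr_left fun j hj => by rw [h j (List.mem_range.1 hj)]

theorem coe_blockProd (r : ℕ → IG S) (i k : ℕ) :
    ((blockProd r i k : IG S) : WithOne (IG S)) = (igSeg r i (k + 1)).prod := by
  induction k with
  | zero => simp [blockProd, igSeg]
  | succ k ih =>
    rw [igSeg_add, List.prod_append, ← ih]
    simp [blockProd, igSeg]

theorem isIrrRSeq_iff {m : ℕ} {r : ℕ → IG S} :
    IsIrrRSeq m r ↔ 1 ≤ m ∧ IsIrrList (IdemClass igGen) (igSeg r 1 m) := by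
  refine and_congr_right fun hm => ⟨fun ⟨h, h'⟩ => ⟨?_, ?_⟩, fun h => ⟨?_, ?_⟩⟩
  · intro a ha
    obtain ⟨j, hj, rfl⟩ := List.mem_map.1 ha
    have := List.mem_range.1 hj
    exact (isRegularElem_iff _).1 (h _ (by omega) (by omega))
  · refine List.isChain_iff_getElem.2 fun j hj => ?_
    rw [length_igSeg] at hj
    have := h' (1 + j) (1 + j + 1) (by omega) (by omega) (by omega)
    rw [isRegularElem_iff, Nat.add_sub_cancel_left] at this
    simpa [igSeg, blockProd, add_assoc] using this
  · intro i hi him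
    refine (isRegularElem_iff _).2 (h.1 _ (List.mem_map.2 ⟨i - 1, ?_, ?_⟩))
    · exact List.mem_range.2 (by omega)
    · rw [Nat.add_sub_cancel' hi]
  · intro i j hi hij hj
    rw [isRegularElem_iff, coe_blockProd]
    have hsub : igSeg r i (j - i + 1) <:+: igSeg r 1 m := by
      obtain ⟨i, rfl⟩ := Nat.exists_eq_add_of_le hi
      obtain ⟨n, rfl⟩ : ∃ n, m = i + (j - (1 + i) + 1) + n := ⟨m - j, by omega⟩
      rw [igSeg_add _ 1, igSeg_add _ 1 i]
      exact ⟨_, _, rfl⟩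
    have := h.infix hsub
    obtain ⟨k, hk⟩ : ∃ k, j - i = k + 1 := ⟨j - i - 1, by omega⟩
    rw [hk, igSeg_succ, igSeg_succ] at this ⊢
    exact this.not_prod isSplitPred_igGen

theorem exists_igSeg_eq {l : List (WithOne (IG S))} (hl : IsIrrList (IdemClass igGen) l)
    (r : ℕ → IG S) : ∃ s, igSeg s 1 l.length = l := by
  lift l to List (IG S) using fun a ha => (hl.1 a ha).ne_one
  refine ⟨fun j => l.getD (j - 1) (r j), List.ext_getElem (by simp [igSeg]) fun j hj hj' => ?_⟩
  rw [List.length_map] at hj'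
  simp [igSeg, hj']

theorem RSwap.symm {m : ℕ} {r s : ℕ → IG S} (h : RSwap m r s) : RSwap m s r := by
  obtain ⟨hr, hs, k, h1, hk, hl, h⟩ := h
  exact ⟨hs, hr, k, h1, hk, fun l h1 h2 h3 h4 => (hl l h1 h2 h3 h4).symm, h.symm⟩

theorem RSwap.of_irrSwap {m : ℕ} {r s : ℕ → IG S} (hr : IsIrrRSeq m r) (hs : IsIrrRSeq m s)
    (h : IrrSwap igGen (IdemClass igGen) ⟨igSeg r 1 m, (isIrrRSeq_iff.1 hr).2⟩
      ⟨igSeg s 1 m, (isIrrRSeq_iff.1 hs).2⟩) : RSwap m r s := by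
  obtain ⟨A, x, e, c, C, h, h'⟩ := h
  dsimp only at h h'
  have hm := congrArg List.length h
  simp only [length_igSeg, List.length_append, List.length_cons] at hm
  have hget : ∀ j < m, some (r (1 + j) : WithOne (IG S)) =
      (A ++ (x * igGen e) :: c :: C)[j]? ∧
      some (s (1 + j) : WithOne (IG S)) = (A ++ x :: (igGen e * c) :: C)[j]? := fun j hj => by
    rw [← h, ← h', igSeg_getElem? r 1 hj, igSeg_getElem? s 1 hj]
    exact ⟨rfl, rfl⟩
  refine ⟨hr, hs, A.length + 1, by omega, by omega, fun l h1 hlm hl hl' => ?_, .inl ⟨e, ?_, ?_⟩⟩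
  · obtain ⟨j, rfl⟩ := Nat.exists_eq_add_of_le h1
    obtain ⟨h₁, h₂⟩ := hget j (by omega)
    refine WithOne.coe_injective (Option.some_injective _ (h₁.trans (.trans ?_ h₂.symm)))
    rcases lt_or_ge j A.length with hj | hj
    · rw [List.getElem?_append_left hj, List.getElem?_append_left hj]
    · rw [List.getElem?_append_right hj, List.getElem?_append_right hj]
      obtain ⟨t, ht⟩ : ∃ t, j - A.length = t + 1 + 1 := ⟨j - A.length - 2, by omega⟩
      rw [ht]
      simp
  · obtain ⟨h₁, h₂⟩ := hget A.length (by omega)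
    simp only [le_refl,
      List.getElem?_append_right, tsub_self, List.getElem?_cons_zero, Option.some.injEq] at h₁ h₂
    refine WithOne.coe_injective ?_
    rw [add_comm, WithOne.coe_mul, h₁, h₂]
    rfl
  · obtain ⟨h₁, h₂⟩ := hget (A.length + 1) (by omega)
    simp only [List.getElem?_append_right (Nat.le_succ A.length), Nat.succ_eq_add_one,
      Nat.add_sub_cancel_left, List.getElem?_cons_succ, List.getElem?_cons_zero,
      Option.some.injEq] at h₁ h₂
    refine WithOne.coe_injective ?_
    rw [add_comm (A.length + 1), WithOne.coe_mul, h₁, h₂]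
    rfl

theorem eqOnWindow_of_igSeg_eq {m : ℕ} {r s : ℕ → IG S} (h : igSeg r 1 m = igSeg s 1 m) :
    EqOnWindow m r s := fun l h1 hl => by
  obtain ⟨j, rfl⟩ := Nat.exists_eq_add_of_le h1
  have hj : j < m := by omega
  have := igSeg_getElem? r 1 hj
  rw [h, igSeg_getElem? s 1 hj] at this
  exact WithOne.coe_injective (Option.some_injective _ this.symm)

theorem reflTransGen_of_eqvGen {m : ℕ} (hm : 1 ≤ m)
    {l l' : {l : List (WithOne (IG S)) // IsIrrList (IdemClass igGen) l}}
    (h : Relation.EqvGen (IrrSwap igGen (IdemClass igGen)) l l') :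
    ∀ {r s : ℕ → IG S}, igSeg r 1 m = l.1 → igSeg s 1 m = l'.1 →
      Relation.ReflTransGen (fun a b => RSwap m a b ∨ EqOnWindow m a b) r s := by
  induction h with
  | rel l l' h =>
    obtain ⟨l, hl⟩ := l
    obtain ⟨l', hl'⟩ := l'
    rintro r s rfl rfl
    exact .single (.inl (.of_irrSwap (isIrrRSeq_iff.2 ⟨hm, hl⟩) (isIrrRSeq_iff.2 ⟨hm, hl'⟩) h))
  | refl _ => exact fun hr hs => .single (.inr (eqOnWindow_of_igSeg_eq (hr.trans hs.symm)))
  | symm _ _ _ ih =>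
    intro r s hr hs
    have : Std.Symm fun a b : ℕ → IG S => RSwap m a b ∨ EqOnWindow m a b :=
      ⟨fun _ _ h => h.imp RSwap.symm fun h l h1 hl => (h l h1 hl).symm⟩
    exact Relation.ReflTransGen.stdSymm.symm _ _ (ih hs hr)
  | trans l₁ l₂ l₃ h₁ _ ih ih' =>
    intro r s hr hs
    obtain ⟨t, ht⟩ := exists_igSeg_eq l₂.2 r
    have hlen := (irrClass_invariants isSplitPred_igGen h₁).1
    rw [← hlen, ← hr, length_igSeg] at ht
    exact (ih hr ht).trans (ih' ht hs)

theorem RSwap.prod_eq {m : ℕ} {r s : ℕ → IG S} (h : RSwap m r s) :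
    (igSeg r 1 m).prod = (igSeg s 1 m).prod := by
  obtain ⟨-, -, k, h1, hk, hl, h⟩ := h
  obtain ⟨k, rfl⟩ := Nat.exists_eq_add_of_le h1
  obtain ⟨n, rfl⟩ : ∃ n, m = k + (n + 1 + 1) := ⟨m - k - 2, by omega⟩
  have h₁ : igSeg r 1 k = igSeg s 1 k :=
    igSeg_congr fun j hj => hl _ (by omega) (by omega) (by omega) (by omega)
  have h₂ : igSeg r (1 + k + 1 + 1) n = igSeg s (1 + k + 1 + 1) n :=
    igSeg_congr fun j hj => hl _ (by omega) (by omega) (by omega) (by omega)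
  have h₃ : r (1 + k) * r (1 + k + 1) = s (1 + k) * s (1 + k + 1) := by
    rcases h with ⟨e, h, h'⟩ | ⟨e, h, h'⟩
    · rw [h, h', mul_assoc]
    · rw [h, h', mul_assoc]
  have h₄ := congrArg (WithOne.coe : IG S → WithOne (IG S)) h₃
  rw [WithOne.coe_mul, WithOne.coe_mul] at h₄
  simp only [igSeg_add _ 1 k, igSeg_succ, List.prod_append, List.prod_cons, h₁, h₂]
  rw [← mul_assoc (r _ : WithOne (IG S)), h₄, mul_assoc]

end IG

theorem stmt6 {S : Type*} [Semigroup S] [Finite (IdemE S)]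
    (m : ℕ) (r s : ℕ → IG S) (hr : IsIrrRSeq m r) (hs : IsIrrRSeq m s) :
    blockProd r 1 (m - 1) = blockProd s 1 (m - 1) ↔
      Relation.ReflTransGen (fun a b => RSwap m a b ∨ EqOnWindow m a b) r s := by
  have hm := hr.1
  have hprod : blockProd r 1 (m - 1) = blockProd s 1 (m - 1) ↔
      (igSeg r 1 m).prod = (igSeg s 1 m).prod := by
    rw [← WithOne.coe_inj, coe_blockProd, coe_blockProd, Nat.sub_add_cancel hm]
  rw [hprod]
  constructor
  · intro h
    obtain ⟨act, hact⟩ := exists_igAct (S := S)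
    exact reflTransGen_of_eqvGen hm (eqvGen_of_prod_eq isSplitPred_igGen closure_igGen act hact
      (isIrrRSeq_iff.1 hr).2 (isIrrRSeq_iff.1 hs).2 h) rfl rfl
  · intro h
    clear hs hprod
    induction h with
    | refl => rfl
    | tail _ h ih =>
      refine ih.trans ?_
      rcases h with h | h
      · exact h.prod_eq
      · exact congrArg List.prod (igSeg_congr fun j hj => h _ (by omega) (by omega))
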